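/- arXiv:1912.04353 — 2 statements merged into one kernel-verified Lean document; each statement's English description precedes it below -/
import Mathlib

section
/- Consider the Master Problem (MP) of the discretized Dubins team orienteering problem. For a route r, let its target sequence be the list of targets τ(v) over the vertices v of r in order; two routes in the same class have the same target sequence, and hence the same profit. Let z : R → ℝ be a feasible solution of MP, and suppose that for every target sequence s the class weight w_s = Σ_{r ∈ R : r has target sequence s} z_r is an integer. Then there exists a feasible solution z' : R → {0,1} of MP (obtained by choosing, for each nonempty target sequence s with w_s = 1, one arbitrary route of that class) whose objective value Σ_{r ∈ R} p_r z'_r equals Σ_{r ∈ R} p_r z_r. -/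
open Finset

/-- A route: a duplicate-free finite list of vertices that visits at most one
vertex of each target (the map `τ` assigns each vertex to its target). -/
def IsRoute {V T : Type*} (τ : V → T) (r : List V) : Prop :=
  r.Nodup ∧ (r.map τ).Nodup

/-- The profit of a route: the sum of the scores of the targets it visits. -/
noncomputable def routeProfit {V T : Type*} [DecidableEq T] (τ : V → T) (p : T → ℝ)
    (r : List V) : ℝ :=
  ∑ t ∈ (r.map τ).toFinset, p t

/-- Feasibility for the master problem (MP). -/
def MPFeasible {V T : Type*} [DecidableEq V] [DecidableEq T]
    (τ : V → T) (R : Finset (List V)) (m : ℕ) (z : List V → ℝ) : Prop :=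
  (∀ r ∈ R, 0 ≤ z r) ∧
  (∑ r ∈ R, z r) ≤ (m : ℝ) ∧
  (∀ t : T, ∑ r ∈ R.filter (fun r => t ∈ r.map τ), z r ≤ 1)

/-- Moving the weight of every fibre of `φ` onto one representative of that fibre does not change
the sums of the functions that factor through `φ`. -/
lemma sum_mul_fiber_weight {α β : Type*} [Nonempty α] [DecidableEq α] [DecidableEq β]
    (R : Finset α) (φ : α → β)
    (z : α → ℝ) (f : β → ℝ) :
    ∑ r ∈ R, f (φ r) * (if Function.invFunOn φ (R : Set α) (φ r) = r
        then ∑ q ∈ R with φ q = φ r, z q else 0) = ∑ r ∈ R, f (φ r) * z r := by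
  have hmaps : ∀ r ∈ R, φ r ∈ R.image φ := fun r hr => mem_image_of_mem φ hr
  rw [← sum_fiberwise_of_maps_to hmaps, ← sum_fiberwise_of_maps_to hmaps]
  refine sum_congr rfl fun s hs => ?_
  have hs' : ∃ a ∈ (R : Set α), φ a = s := by simpa using hs
  have hmem : Function.invFunOn φ (R : Set α) s ∈ R := Function.invFunOn_mem hs'
  have heq : φ (Function.invFunOn φ (R : Set α) s) = s := Function.invFunOn_eq hs'
  calc _ = ∑ r ∈ R with φ r = s, if Function.invFunOn φ (R : Set α) s = r
            then f s * ∑ q ∈ R with φ q = s, z q else 0 := by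
        refine sum_congr rfl fun r hr => ?_
        rw [(mem_filter.1 hr).2, mul_ite, mul_zero]
    _ = f s * ∑ q ∈ R with φ q = s, z q := by
        rw [sum_ite_eq, if_pos (mem_filter.2 ⟨hmem, heq⟩)]
    _ = _ := by
        rw [mul_sum]
        refine sum_congr rfl fun r hr => ?_
        rw [(mem_filter.1 hr).2]

/-- The target sequence of a route: the list of targets of its vertices, in order.
Two routes of the same class (same target sequence) have the same profit, and if
every class weight `w_s = ∑_{r : r.map τ = s} z_r` of a feasible LP solution `z`
is integral, then there is a binary feasible solution of MP with the same
objective value. -/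
theorem integral_class_weights_imply_integral_solution
    {V T : Type*} [DecidableEq V] [DecidableEq T]
    (τ : V → T) (p : T → ℝ) (hp : ∀ t, 0 ≤ p t)
    (R : Finset (List V)) (hroutes : ∀ r ∈ R, IsRoute τ r)
    (m : ℕ) (hm : 0 < m)
    (z : List V → ℝ) (hz : MPFeasible τ R m z)
    (hint : ∀ s : List T, ∃ k : ℤ,
      ∑ r ∈ R.filter (fun r => r.map τ = s), z r = (k : ℝ)) :
    (∀ r₁ ∈ R, ∀ r₂ ∈ R, r₁.map τ = r₂.map τ →
        routeProfit τ p r₁ = routeProfit τ p r₂) ∧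
    ∃ z' : List V → ℝ, MPFeasible τ R m z' ∧ (∀ r ∈ R, z' r = 0 ∨ z' r = 1) ∧
      ∑ r ∈ R, routeProfit τ p r * z' r = ∑ r ∈ R, routeProfit τ p r * z r := by
  obtain ⟨hz0, hzm, hzt⟩ := hz
  set w : List T → ℝ := fun s => ∑ q ∈ R with q.map τ = s, z q with hw
  have hw0 : ∀ s, 0 ≤ w s := fun s => sum_nonneg fun q hq => hz0 q (mem_filter.1 hq).1
  have hw01 : ∀ s, s ≠ [] → w s = 0 ∨ w s = 1 := by
    intro s hs
    obtain ⟨t, ht⟩ := List.exists_mem_of_ne_nil s hs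
    have hw1 : w s ≤ 1 := by
      refine le_trans (sum_le_sum_of_subset_of_nonneg ?_ ?_) (hzt t)
      · intro q hq
        obtain ⟨hqR, hqs⟩ := mem_filter.1 hq
        exact mem_filter.2 ⟨hqR, hqs ▸ ht⟩
      · exact fun q hq _ => hz0 q (mem_filter.1 hq).1
    obtain ⟨k, hk⟩ := hint s
    have hwk : w s = k := hk
    have hk0 : 0 ≤ k := by exact_mod_cast hwk ▸ hw0 s
    have hk1 : k ≤ 1 := by exact_mod_cast hwk ▸ hw1
    obtain rfl | rfl : k = 0 ∨ k = 1 := by omega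
    · exact Or.inl (by simpa using hwk)
    · exact Or.inr (by simpa using hwk)
  set u : List V → ℝ := fun r =>
    if Function.invFunOn (List.map τ) (R : Set (List V)) (r.map τ) = r
      then w (r.map τ) else 0 with hu
  -- The class of the empty route may have weight larger than one, so it is dropped.
  set z' : List V → ℝ := fun r => if r.map τ = [] then 0 else u r with hz'
  have hsum : ∀ f : List T → ℝ, f [] = 0 →
      ∑ r ∈ R, f (r.map τ) * z' r = ∑ r ∈ R, f (r.map τ) * z r := by
    intro f hf
    rw [← sum_mul_fiber_weight R (List.map τ) z f]
    refine sum_congr rfl fun r _ => ?_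
    by_cases h : r.map τ = []
    · rw [h, hf, zero_mul, zero_mul]
    · simp only [hz', hu, hw, if_neg h]
  have hz'01 : ∀ r, z' r = 0 ∨ z' r = 1 := by
    intro r
    by_cases h : r.map τ = []
    · exact Or.inl (if_pos h)
    · simp only [hz', hu, if_neg h]
      split_ifs
      · exact hw01 _ h
      · exact Or.inl rfl
  refine ⟨fun r₁ _ r₂ _ h => by rw [routeProfit, routeProfit, h],
    z', ⟨fun r _ => ?_, ?_, fun t => ?_⟩, fun r _ => hz'01 r, ?_⟩
  · rcases hz'01 r with h | h <;> rw [h]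
    exact zero_le_one
  · calc ∑ r ∈ R, z' r = ∑ r ∈ R, (if r.map τ = [] then 0 else 1) * z' r := by
          refine sum_congr rfl fun r _ => ?_
          by_cases h : r.map τ = []
          · simp only [hz', if_pos h, mul_zero]
          · rw [if_neg h, one_mul]
      _ = ∑ r ∈ R, (if r.map τ = [] then 0 else 1) * z r :=
          hsum (fun s => if s = [] then 0 else 1) (if_pos rfl)
      _ ≤ ∑ r ∈ R, z r := by
          refine sum_le_sum fun r hr => ?_
          split_ifs
          · simpa using hz0 r hr
          · rw [one_mul]
      _ ≤ m := hzm
  · have h := hsum (fun s => if t ∈ s then 1 else 0) (if_neg List.not_mem_nil)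
    simp only [ite_mul, one_mul, zero_mul] at h
    rw [← sum_filter, ← sum_filter] at h
    exact h.trans_le (hzt t)
  · exact hsum (fun s => ∑ t ∈ s.toFinset, p t) (by simp)
end

section
/- Let z : R → ℝ be a feasible solution of the Master Problem (MP) such that for every target t ∈ T the flow f_t = Σ_{r ∈ R, r visits t} z_r is an integer. Then f_t ∈ {0, 1} for every target t, no route in the support of z visits a target with f_t = 0, and the objective value of z satisfies Σ_{r ∈ R} p_r z_r = Σ_{t ∈ T : f_t = 1} p_t. -/
open Finset

/-- The flow into target `t` under a solution `z` of MP. -/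
def targetFlow {V T : Type*} [DecidableEq V] [DecidableEq T]
    (τ : V → T) (R : Finset (List V)) (z : List V → ℝ) (t : T) : ℝ :=
  ∑ r ∈ R.filter (fun r => t ∈ r.map τ), z r

/-- An integral real number in the unit interval is `0` or `1`. -/
theorem zero_or_one_of_int {x : ℝ} (h0 : 0 ≤ x) (h1 : x ≤ 1) (hx : ∃ k : ℤ, x = (k : ℝ)) :
    x = 0 ∨ x = 1 := by
  obtain ⟨k, rfl⟩ := hx
  norm_cast at h0 h1 ⊢
  lia

theorem targetFlow_nonneg {V T : Type*} [DecidableEq V] [DecidableEq T] (τ : V → T)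
    {R : Finset (List V)} {z : List V → ℝ} (hz : ∀ r ∈ R, 0 ≤ z r) (t : T) :
    0 ≤ targetFlow τ R z t :=
  Finset.sum_nonneg fun r hr => hz r (Finset.mem_filter.mp hr).1

/-- The objective value is the total score weighted by the target flows. -/
theorem sum_routeProfit_mul {V T : Type*} [DecidableEq V] [DecidableEq T] [Fintype T]
    (τ : V → T) (p : T → ℝ) (R : Finset (List V)) (z : List V → ℝ) :
    ∑ r ∈ R, routeProfit τ p r * z r = ∑ t, p t * targetFlow τ R z t := by
  simp_rw [routeProfit, targetFlow, Finset.sum_mul, Finset.mul_sum]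
  refine Finset.sum_comm' fun r t => ?_
  simp only [Finset.mem_filter, List.mem_toFinset, Finset.mem_univ, and_true]

/-- If a feasible solution of MP has integral flow into every target, then every
target flow is `0` or `1`, no route in the support visits a target with zero flow,
and the objective value equals the total score of the targets with unit flow. -/
theorem integral_flows_structure
    {V T : Type*} [DecidableEq V] [DecidableEq T] [Fintype T]
    (τ : V → T) (p : T → ℝ) (hp : ∀ t, 0 ≤ p t)
    (R : Finset (List V)) (hroutes : ∀ r ∈ R, IsRoute τ r)
    (m : ℕ) (hm : 0 < m)
    (z : List V → ℝ) (hz : MPFeasible τ R m z)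
    (hint : ∀ t : T, ∃ k : ℤ, targetFlow τ R z t = (k : ℝ)) :
    (∀ t : T, targetFlow τ R z t = 0 ∨ targetFlow τ R z t = 1) ∧
    (∀ r ∈ R, z r ≠ 0 → ∀ t : T, targetFlow τ R z t = 0 → t ∉ r.map τ) ∧
    ∑ r ∈ R, routeProfit τ p r * z r =
      ∑ t ∈ Finset.univ.filter (fun t : T => targetFlow τ R z t = 1), p t := by
  obtain ⟨hnonneg, -, hcap⟩ := hz
  have h01 : ∀ t : T, targetFlow τ R z t = 0 ∨ targetFlow τ R z t = 1 :=
    fun t => zero_or_one_of_int (targetFlow_nonneg τ hnonneg t) (hcap t) (hint t)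
  refine ⟨h01, fun r hr hzr t ht hmem => hzr ?_, ?_⟩
  · exact (Finset.sum_eq_zero_iff_of_nonneg
      fun s hs => hnonneg s (Finset.mem_filter.mp hs).1).mp ht r
      (Finset.mem_filter.mpr ⟨hr, hmem⟩)
  · rw [sum_routeProfit_mul, Finset.sum_filter]
    refine Finset.sum_congr rfl fun t _ => ?_
    rcases h01 t with h | h <;> simp [h]
end
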